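/- Assume Setting 3. Then there exists c > 0 such that for all t = 1,…,T−1, all j ≥ 0, every cube G ∈ Φ^{N,j}_t, all x > 0 and all N_G ∈ ℕ: P[|W(μ_G, (μ_G)^{N_G}) − E[W(μ_G, (μ_G)^{N_G})]| ≥ x] ≤ 2 exp(−c N_G x² / ((1 + diam(G))²(1 + ‖G‖^r)²)), where (μ_G)^{N_G} denotes the empirical measure of N_G i.i.d. samples drawn from μ_G. -/

import Mathlib

open MeasureTheory ProbabilityTheory Filter Set
open scoped ENNReal NNReal Topology Classical

noncomputable section

namespace AWPaper

/-- The state space `ℝ^d` with Euclidean norm. -/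
abbrev E (d : ℕ) := EuclideanSpace ℝ (Fin d)

/-- Paths of length `t` with values in `ℝ^d`. -/
abbrev PathT (d t : ℕ) := Fin t → E d

/-- Sum-norm `‖x‖ = ∑_t ‖x_t‖` of a (partial) path. -/
def sumNorm {d t : ℕ} (a : PathT d t) : ℝ := ∑ s, ‖a s‖

/-- Sum-distance `∑_t ‖x_t - y_t‖` of two (partial) paths. -/
def sumDist {d t : ℕ} (a b : PathT d t) : ℝ := ∑ s, ‖a s - b s‖

/-- Couplings of two measures. -/
def Cpl {α β : Type*} [MeasurableSpace α] [MeasurableSpace β]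
    (μ : Measure α) (ν : Measure β) : Set (Measure (α × β)) :=
  {π | π.map Prod.fst = μ ∧ π.map Prod.snd = ν}

/-- First order Wasserstein distance (with value in `ℝ≥0∞`). -/
def W1 {α : Type*} [MeasurableSpace α] [PseudoEMetricSpace α]
    (μ ν : Measure α) : ℝ≥0∞ :=
  ⨅ π ∈ Cpl μ ν, ∫⁻ p, edist p.1 p.2 ∂π

/-- Restriction of a path to its first `t` coordinates. -/
def restr (d T : ℕ) {t : ℕ} (h : t ≤ T) : PathT d T → PathT d t :=
  fun x i => x (Fin.castLE h i)

/-- The pair (first `t` coordinates, coordinate `t`); used for disintegration. -/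
def frontMap (d T : ℕ) {t : ℕ} (ht : t < T) : PathT d T → PathT d t × E d :=
  fun x => (restr d T ht.le x, x ⟨t, ht⟩)

/-- Totalized version of `Measure.condKernel` (zero measure if the joint measure is not
finite). -/
def condKerTotal {α Ω : Type*} [MeasurableSpace α] [MeasurableSpace Ω]
    [StandardBorelSpace Ω] [Nonempty Ω] (ρ : Measure (α × Ω)) : α → Measure Ω :=
  if h : IsFiniteMeasure ρ then fun a => (@Measure.condKernel α Ω _ _ _ _ ρ h) a
  else fun _ => 0

/-- The (canonical) kernel `μ_{x_{1:t}}` of `μ`: the disintegration of the law of the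
`(t+1)`-st coordinate given the first `t` coordinates. -/
def muKer {d T : ℕ} (μ : Measure (PathT d T)) {t : ℕ} (ht : t < T) :
    PathT d t → Measure (E d) :=
  condKerTotal (μ.map (frontMap d T ht))

/-- Joint restriction map for couplings. -/
def pairFront (d T : ℕ) {t : ℕ} (ht : t < T) :
    PathT d T × PathT d T → (PathT d t × PathT d t) × (E d × E d) :=
  fun p => ((restr d T ht.le p.1, restr d T ht.le p.2), (p.1 ⟨t, ht⟩, p.2 ⟨t, ht⟩))

/-- A coupling `π` of `μ` and `ν` is bi-causal if for each `t = 1,…,T-1` the disintegration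
of `π` given the first `t` coordinates of both paths is (a.e.) a coupling of the
corresponding kernels of `μ` and `ν`. -/
def Bicausal {d T : ℕ} (μ ν : Measure (PathT d T))
    (π : Measure (PathT d T × PathT d T)) : Prop :=
  π ∈ Cpl μ ν ∧
  ∀ (t : ℕ) (ht : t < T), 1 ≤ t →
    ∀ᵐ ab ∂(π.map (fun p => (restr d T ht.le p.1, restr d T ht.le p.2))),
      condKerTotal (π.map (pairFront d T ht)) ab ∈ Cpl (muKer μ ht ab.1) (muKer ν ht ab.2)

/-- The (first order) adapted Wasserstein distance. -/
def AW {d T : ℕ} (μ ν : Measure (PathT d T)) : ℝ≥0∞ :=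
  ⨅ π ∈ {π | Bicausal μ ν π}, ∫⁻ p, (∑ t, edist (p.1 t) (p.2 t)) ∂π

/-- Empirical measure of the first `N` elements of a sequence of samples. -/
def emp {α : Type*} [MeasurableSpace α] (x : ℕ → α) (N : ℕ) : Measure α :=
  (N : ℝ≥0∞)⁻¹ • ∑ n ∈ Finset.range N, Measure.dirac (x n)

/-- Empirical measure of a finite family of samples. -/
def empFin {α : Type*} [MeasurableSpace α] {k : ℕ} (y : Fin k → α) : Measure α :=
  (k : ℝ≥0∞)⁻¹ • ∑ i, Measure.dirac (y i)

/-- The grid size `Δ_N = N^{-1/(dT)}`. -/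
def ΔN (d T N : ℕ) : ℝ := (N : ℝ) ^ (-(1 : ℝ) / (d * T))

/-- `m = ⌈1/Δ_N⌉`. -/
def mOf (d T N : ℕ) : ℕ := ⌈(1 : ℝ) / ΔN d T N⌉₊

/-- Midpoint of the grid cube of side length `s` containing `u`. -/
def gridPt (s u : ℝ) : ℝ := (⌊u / s⌋ + 2⁻¹) * s

/-- Projection of a path onto the midpoints of the uniform grid of side `1/m`,
`m = ⌈N^{1/(dT)}⌉`. -/
def unifProj (d T N : ℕ) : PathT d T → PathT d T :=
  fun x t => (WithLp.equiv 2 (Fin d → ℝ)).symm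
    (fun i => gridPt ((mOf d T N : ℝ))⁻¹ (x t i))

/-- The sup-norm over all real coordinates of a (partial) path. -/
def supA {d t : ℕ} (a : PathT d t) : ℝ≥0 :=
  Finset.univ.sup (fun p : Fin t × Fin d => ‖a p.1 p.2‖₊)

lemma ringIdx_ex {d t : ℕ} (a : PathT d t) : ∃ j : ℕ, supA a ≤ 2 ^ j :=
  (pow_unbounded_of_one_lt (supA a) one_lt_two).imp fun _ h => h.le

/-- The index of the cubic ring `A_j` containing a given point: the least `j` with
`‖a‖_∞ ≤ 2^j`. -/
def ringIdx {d t : ℕ} (a : PathT d t) : ℕ := Nat.find (ringIdx_ex a)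

/-- The cubic ring `A^t_j` (points whose ring index is `j`). -/
def ringSet (d t : ℕ) (j : ℕ) : Set (PathT d t) := {a | ringIdx a = j}

/-- Side length `2^{j-1}/m` of the cubes of the non-uniform grid inside the ring `A_j`. -/
def sideLen (m j : ℕ) : ℝ := (2 : ℝ) ^ ((j : ℤ) - 1) / m

/-- Projection of a path onto the midpoints of the non-uniform grid. -/
def nonUnifProj (d T N : ℕ) : PathT d T → PathT d T :=
  fun x t => (WithLp.equiv 2 (Fin d → ℝ)).symm
    (fun i => gridPt (sideLen (mOf d T N) (ringIdx x)) (x t i))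

/-- Index set for the cubes of the uniform grid on `ℝ^{dt}`. -/
abbrev Idx (d t : ℕ) := Fin t → Fin d → ℤ

/-- Cube of the uniform grid of side `1/m` on `ℝ^{dt}`. -/
def unifCell (d t m : ℕ) (z : Idx d t) : Set (PathT d t) :=
  {a | ∀ s i, ⌊a s i * m⌋ = z s i}

/-- Cube of the non-uniform grid, inside the ring `A^t_j`. -/
def nonUnifCell (d t m : ℕ) (j : ℕ) (z : Idx d t) : Set (PathT d t) :=
  {a | ringIdx a = j ∧ ∀ s i, ⌊a s i / sideLen m j⌋ = z s i}

/-- The cubes of the uniform grid. -/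
def unifCells (d t m : ℕ) : Set (Set (PathT d t)) := Set.range (unifCell d t m)

/-- The cubes of the non-uniform grid. -/
def nonUnifCells (d t m : ℕ) : Set (Set (PathT d t)) :=
  Set.range (fun p : ℕ × Idx d t => nonUnifCell d t m p.1 p.2)

/-- Mass given by (the up-to-time-`t` marginal of) `ρ` to a set `G ⊆ ℝ^{dt}`. -/
def cellMass {d T : ℕ} (ρ : Measure (PathT d T)) {t : ℕ} (h : t ≤ T)
    (G : Set (PathT d t)) : ℝ≥0∞ :=
  ρ (restr d T h ⁻¹' G)

/-- The average kernel `μ_G` of `μ` on `G`: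
`μ_G(B) = μ(X_{1:t} ∈ G, X_{t+1} ∈ B)/μ(X_{1:t} ∈ G)`, and `δ_0` if `μ(X_{1:t} ∈ G) = 0`. -/
def avgKer {d T : ℕ} (μ : Measure (PathT d T)) {t : ℕ} (ht : t < T)
    (G : Set (PathT d t)) : Measure (E d) :=
  if μ (restr d T ht.le ⁻¹' G) = 0 then Measure.dirac 0
  else (μ (restr d T ht.le ⁻¹' G))⁻¹ •
    ((μ.restrict (restr d T ht.le ⁻¹' G)).map (fun x => x ⟨t, ht⟩))

/-- `‖G‖ = sup_{x ∈ G} ‖x‖` (sum-norm), with value in `ℝ≥0∞`. -/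
def cellNorm {d t : ℕ} (G : Set (PathT d t)) : ℝ≥0∞ :=
  ⨆ a ∈ G, ∑ s, (‖a s‖₊ : ℝ≥0∞)

/-- `diam(G) = sup_{x,y ∈ G} ‖x - y‖` (sum-norm), with value in `ℝ≥0∞`. -/
def cellDiam {d t : ℕ} (G : Set (PathT d t)) : ℝ≥0∞ :=
  ⨆ a ∈ G, ⨆ b ∈ G, ∑ s, edist (a s) (b s)

/-- `p`-th moment `M_p(ρ) = ∫ ‖y‖^p dρ` of a measure on `ℝ^d`. -/
def Mp {d : ℕ} (p : ℝ) (ρ : Measure (E d)) : ℝ≥0∞ :=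
  ∫⁻ y, (‖y‖₊ : ℝ≥0∞) ^ p ∂ρ

/-- `(α,γ)`-exponential moment `E_{α,γ}(ρ) = ∫ exp(γ‖y‖^α) dρ` of a measure on `ℝ^d`. -/
def ExpM {d : ℕ} (α γ : ℝ) (ρ : Measure (E d)) : ℝ≥0∞ :=
  ∫⁻ y, ENNReal.ofReal (Real.exp (γ * ‖y‖ ^ α)) ∂ρ

/-- `q`-th moment of a measure on path space (with the sum-norm). -/
def pathMom {d T : ℕ} (q : ℝ) (μ : Measure (PathT d T)) : ℝ≥0∞ :=
  ∫⁻ x, (ENNReal.ofReal (sumNorm x)) ^ q ∂μ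

/-- `K` is a disintegration (kernel family) of the `(t+1)`-st coordinate of `μ` given the
first `t` coordinates. -/
def IsDisint {d T : ℕ} (μ : Measure (PathT d T)) {t : ℕ} (ht : t < T)
    (K : PathT d t → Measure (E d)) : Prop :=
  (∀ a, IsProbabilityMeasure (K a)) ∧
  (∀ B : Set (E d), MeasurableSet B → Measurable fun a => K a B) ∧
  ∀ (A : Set (PathT d t)) (B : Set (E d)), MeasurableSet A → MeasurableSet B →
    μ ((restr d T ht.le ⁻¹' A) ∩ ((fun x => x ⟨t, ht⟩) ⁻¹' B))
      = ∫⁻ a in A, K a B ∂(μ.map (restr d T ht.le))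

/-- `μ` has `L`-Lipschitz kernels: some disintegration is `L`-Lipschitz w.r.t. the
Wasserstein distance. -/
def HasLipKernels (d T : ℕ) (L : ℝ) (μ : Measure (PathT d T)) : Prop :=
  ∃ K : (t : ℕ) → t < T → PathT d t → Measure (E d),
    ∀ (t : ℕ) (ht : t < T), 1 ≤ t → IsDisint μ ht (K t ht) ∧
      ∀ a b, W1 (K t ht a) (K t ht b) ≤ ENNReal.ofReal (L * sumDist a b)

/-- The noise-kernel decomposition data of a measure `μ` on path space:
kernels `K`, functions `f_t`, `σ_t` and noise laws `λ_{x_{1:t}}` with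
`μ_{x_{1:t}} = law of f_t(x_{1:t}) + σ_t(x_{1:t})·ε`, `ε ∼ λ_{x_{1:t}}`. -/
structure KernelData (d T : ℕ) (μ : Measure (PathT d T)) where
  K : (t : ℕ) → t < T → PathT d t → Measure (E d)
  f : (t : ℕ) → t < T → PathT d t → E d
  sig : (t : ℕ) → t < T → PathT d t → ℝ
  lam : (t : ℕ) → t < T → PathT d t → Measure (E d)
  disint : ∀ (t : ℕ) (ht : t < T), 1 ≤ t → IsDisint μ ht (K t ht)
  lamProb : ∀ (t : ℕ) (ht : t < T) (a : PathT d t), IsProbabilityMeasure (lam t ht a)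
  sigNonneg : ∀ (t : ℕ) (ht : t < T) (a : PathT d t), 0 ≤ sig t ht a
  decomp : ∀ (t : ℕ) (ht : t < T) (a : PathT d t), 1 ≤ t →
    K t ht a = (lam t ht a).map (fun e => f t ht a + sig t ht a • e)

/-- The kernels are `L`-Lipschitz w.r.t. the Wasserstein distance. -/
def KernelData.Lip {d T : ℕ} {μ : Measure (PathT d T)} (κ : KernelData d T μ)
    (L : ℝ) : Prop :=
  ∀ (t : ℕ) (ht : t < T), 1 ≤ t → ∀ a b,
    W1 (κ.K t ht a) (κ.K t ht b) ≤ ENNReal.ofReal (L * sumDist a b)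

/-- Growth condition `σ_t(x_{1:t}) ≤ c ‖x_{1:t}‖^r`. -/
def KernelData.Growth {d T : ℕ} {μ : Measure (PathT d T)} (κ : KernelData d T μ)
    (c r : ℝ) : Prop :=
  ∀ (t : ℕ) (ht : t < T) (a : PathT d t), 1 ≤ t → κ.sig t ht a ≤ c * sumNorm a ^ r

/-- The functions `f_t` are `L_f`-Lipschitz. -/
def KernelData.fLip {d T : ℕ} {μ : Measure (PathT d T)} (κ : KernelData d T μ)
    (Lf : ℝ) : Prop :=
  ∀ (t : ℕ) (ht : t < T), 1 ≤ t → ∀ a b,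
    ‖κ.f t ht a - κ.f t ht b‖ ≤ Lf * sumDist a b

/-- `D(d) = d+1` for `d ∈ {1,2}` and `D(d) = d` for `d ≥ 3`. -/
def Dd (d : ℕ) : ℝ := if d ≤ 2 then (d : ℝ) + 1 else (d : ℝ)

/-- Common part of Settings 1 and 2. -/
structure SettingBase (d T : ℕ) (r p L Lf : ℝ) (μ : Measure (PathT d T))
    (κ : KernelData d T μ) : Prop where
  hd : 0 < d
  hT : 2 ≤ T
  hr : 0 ≤ r
  hp : 1 ≤ p
  hLf : 0 < Lf
  hprob : IsProbabilityMeasure μ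
  hLip : κ.Lip L
  hgrow : ∃ c : ℝ, 0 < c ∧ κ.Growth c r
  hfLip : κ.fLip Lf
  hmom : ∃ M : ℝ≥0∞, M ≠ ⊤ ∧ ∀ (t : ℕ) (ht : t < T), 1 ≤ t → ∀ a, Mp p (κ.lam t ht a) ≤ M

/-- Setting 1. -/
def Setting1 (d T : ℕ) (r p q L Lf : ℝ) (μ : Measure (PathT d T))
    (κ : KernelData d T μ) : Prop :=
  SettingBase d T r p L Lf μ κ ∧
  max ((Dd d / (Dd d - 1)) * (r + T - 1)) (r * p + Dd d * (T - 1) * (p - 1)) < q ∧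
  pathMom q μ < ⊤

/-- Setting 2. -/
def Setting2 (d T : ℕ) (r p q L Lf : ℝ) (μ : Measure (PathT d T))
    (κ : KernelData d T μ) : Prop :=
  SettingBase d T r p L Lf μ κ ∧
  max (r * Dd d / (Dd d - 1)) ((r + 1) * p) < q ∧
  pathMom q μ < ⊤

/-- Setting 3. -/
structure Setting3 (d T : ℕ) (r α γ L Lf : ℝ) (μ : Measure (PathT d T))
    (κ : KernelData d T μ) : Prop where
  hd : 0 < d
  hT : 2 ≤ T
  hr : 0 ≤ r
  hα : 2 ≤ α
  hγ : 0 < γ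
  hLf : 0 < Lf
  hprob : IsProbabilityMeasure μ
  hexpmom : ∫⁻ x, ENNReal.ofReal (Real.exp (γ * sumNorm x ^ α)) ∂μ < ⊤
  hLip : κ.Lip L
  hgrow : ∃ c : ℝ, 0 < c ∧ κ.Growth c r
  hfLip : κ.fLip Lf
  hulam : ∃ M : ℝ≥0∞, M ≠ ⊤ ∧ ∀ (t : ℕ) (ht : t < T), 1 ≤ t → ∀ a,
    ExpM α γ (κ.lam t ht a) ≤ M

end AWPaper
namespace AWPaper

lemma cosh_mul_le (u v : ℝ) :
    Real.cosh (u * v) ≤ 1 + (Real.exp (u ^ 2) - 1) * Real.exp (v ^ 2) := by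
  have h1 : Real.cosh (u * v) ≤ Real.exp (u ^ 2 * v ^ 2 / 2) := by
    simpa [mul_pow] using Real.cosh_le_exp_half_sq (u * v)
  have hv : 1 ≤ Real.exp (v ^ 2) := Real.one_le_exp (sq_nonneg v)
  have hu1 : u ^ 2 ≤ Real.exp (u ^ 2) - 1 := by
    have := Real.add_one_le_exp (u ^ 2)
    linarith
  rcases le_total (u ^ 2) 1 with hu | hu
  · have h2 : Real.exp (u ^ 2 * v ^ 2) ≤ (1 - u ^ 2) * 1 + u ^ 2 * Real.exp (v ^ 2) := by
      have := convexOn_exp.2 (mem_univ (0 : ℝ)) (mem_univ (v ^ 2)) (sub_nonneg.2 hu)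
        (sq_nonneg u) (by ring)
      simpa using this
    have h3 : Real.exp (u ^ 2 * v ^ 2 / 2) ≤ Real.exp (u ^ 2 * v ^ 2) :=
      Real.exp_le_exp.2 (half_le_self (by positivity))
    nlinarith [sq_nonneg u]
  · have h2 : Real.cosh (u * v) ≤ Real.exp (u ^ 2 / 2) * Real.exp (v ^ 2 / 2) := by
      rw [← Real.exp_add, Real.cosh_eq]
      have h3 : Real.exp (u * v) ≤ Real.exp (u ^ 2 / 2 + v ^ 2 / 2) :=
        Real.exp_le_exp.2 (by nlinarith [sq_nonneg (u - v)])
      have h4 : Real.exp (-(u * v)) ≤ Real.exp (u ^ 2 / 2 + v ^ 2 / 2) :=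
        Real.exp_le_exp.2 (by nlinarith [sq_nonneg (u + v)])
      linarith
    have eu : Real.exp (u ^ 2) = Real.exp (u ^ 2 / 2) ^ 2 := by
      rw [← Real.exp_nat_mul]; congr 1; push_cast; ring
    have ev : Real.exp (v ^ 2) = Real.exp (v ^ 2 / 2) ^ 2 := by
      rw [← Real.exp_nat_mul]; congr 1; push_cast; ring
    have hp : 1.62 ≤ Real.exp (u ^ 2 / 2) := by
      refine (sq_le_sq₀ (by norm_num) (Real.exp_pos _).le).1 ?_
      rw [← eu]
      have := Real.exp_le_exp.2 hu
      linarith [Real.exp_one_gt_d9]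
    have hq : 1 ≤ Real.exp (v ^ 2 / 2) := Real.one_le_exp (by positivity)
    rw [eu, ev]
    set p := Real.exp (u ^ 2 / 2)
    set q := Real.exp (v ^ 2 / 2)
    have hpp : p ≤ p ^ 2 - 1 := by nlinarith
    have hqq : q ≤ q ^ 2 := by nlinarith
    have : p * q ≤ (p ^ 2 - 1) * q ^ 2 := by gcongr; linarith
    linarith

lemma one_add_exp_sub_one_mul_le {w B : ℝ} (hB : 1 ≤ B) :
    1 + (Real.exp w - 1) * B ≤ Real.exp (B * w) := by
  have := one_add_mul_self_le_rpow_one_add (s := Real.exp w - 1) (p := B)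
    (by linarith [Real.exp_pos w]) hB
  rw [add_sub_cancel, ← Real.exp_mul] at this
  rw [mul_comm B w]
  linarith

lemma ofReal_exp_integral_le {α : Type*} [MeasurableSpace α] {P : Measure α}
    [IsProbabilityMeasure P] {h : α → ℝ} (hi : Integrable h P) :
    ENNReal.ofReal (Real.exp (∫ y, h y ∂P)) ≤ ∫⁻ y, ENNReal.ofReal (Real.exp (h y)) ∂P := by
  by_cases ht : ∫⁻ y, ENNReal.ofReal (Real.exp (h y)) ∂P = ⊤
  · simp [ht]
  have hintg : Integrable (fun y => Real.exp (h y)) P := by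
    refine ⟨Real.continuous_exp.comp_aestronglyMeasurable hi.1, ?_⟩
    rw [hasFiniteIntegral_iff_ofReal (Eventually.of_forall fun y => (Real.exp_pos _).le)]
    exact lt_top_iff_ne_top.2 ht
  rw [← ofReal_integral_eq_lintegral_ofReal hintg
    (Eventually.of_forall fun y => (Real.exp_pos _).le)]
  exact ENNReal.ofReal_le_ofReal
    (convexOn_exp.map_integral_le Real.continuous_exp.continuousOn isClosed_univ (by simp) hi hintg)

lemma lintegral_exp_sub_eq_lintegral_cosh_sub {α : Type*} [MeasurableSpace α] {P : Measure α}
    [SFinite P] {g : α → ℝ} (hg : Measurable g) :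
    ∫⁻ y, ∫⁻ y', ENNReal.ofReal (Real.exp (g y - g y')) ∂P ∂P =
      ∫⁻ y, ∫⁻ y', ENNReal.ofReal (Real.cosh (g y - g y')) ∂P ∂P := by
  have hm : Measurable fun p : α × α => ENNReal.ofReal (Real.exp (g p.1 - g p.2)) := by fun_prop
  have hsw : ∫⁻ y, ∫⁻ y', ENNReal.ofReal (Real.exp (g y - g y')) ∂P ∂P
      = ∫⁻ y, ∫⁻ y', ENNReal.ofReal (Real.exp (g y' - g y)) ∂P ∂P :=
    lintegral_lintegral_swap hm.aemeasurable
  have hc : ∀ y y', ENNReal.ofReal (Real.cosh (g y - g y')) =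
      2⁻¹ * (ENNReal.ofReal (Real.exp (g y - g y')) + ENNReal.ofReal (Real.exp (g y' - g y))) := by
    intro y y'
    rw [Real.cosh_eq, neg_sub, ← ENNReal.ofReal_add (Real.exp_pos _).le (Real.exp_pos _).le,
      ENNReal.ofReal_div_of_pos two_pos, mul_comm, div_eq_mul_inv, ENNReal.ofReal_ofNat]
  simp_rw [hc]
  have e : ∀ y, ∫⁻ y', 2⁻¹ * (ENNReal.ofReal (Real.exp (g y - g y'))
      + ENNReal.ofReal (Real.exp (g y' - g y))) ∂P =
      2⁻¹ * (∫⁻ y', ENNReal.ofReal (Real.exp (g y - g y')) ∂P +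
        ∫⁻ y', ENNReal.ofReal (Real.exp (g y' - g y)) ∂P) := by
    intro y
    rw [lintegral_const_mul _ (by fun_prop), lintegral_add_left (by fun_prop)]
  simp_rw [e]
  rw [lintegral_const_mul _ (by fun_prop), lintegral_add_left (by fun_prop), ← hsw, ← two_mul,
    ← mul_assoc, ENNReal.inv_mul_cancel (by simp) (by simp), one_mul]

section Concentration

variable {V : Type*} [NormedAddCommGroup V] [MeasurableSpace V] [BorelSpace V]
  [SecondCountableTopology V]

lemma integrable_norm_of_lintegral_exp_sq {P : Measure V} [IsProbabilityMeasure P] {a : V}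
    {S B : ℝ} (hS : 0 < S)
    (hB : ∫⁻ y, ENNReal.ofReal (Real.exp (‖y - a‖ ^ 2 / S ^ 2)) ∂P ≤ ENNReal.ofReal B) :
    Integrable (fun y => ‖y‖) P := by
  have hintg : Integrable (fun y => Real.exp (‖y - a‖ ^ 2 / S ^ 2)) P := by
    refine ⟨by fun_prop, ?_⟩
    rw [hasFiniteIntegral_iff_ofReal (Eventually.of_forall fun y => (Real.exp_pos _).le)]
    exact hB.trans_lt ENNReal.ofReal_lt_top
  refine ((hintg.const_mul S).add (integrable_const ‖a‖)).mono' (by fun_prop)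
    (Eventually.of_forall fun y => ?_)
  have h1 : ‖y‖ ≤ ‖y - a‖ + ‖a‖ := by simpa using norm_add_le (y - a) a
  have h2 : ‖y - a‖ / S ≤ Real.exp (‖y - a‖ ^ 2 / S ^ 2) := by
    have := Real.add_one_le_exp ((‖y - a‖ / S) ^ 2)
    rw [div_pow] at this
    nlinarith [sq_nonneg (‖y - a‖ / S - 1), div_pow ‖y - a‖ S 2]
  rw [div_le_iff₀ hS] at h2
  simp only [norm_norm, Pi.add_apply]
  linarith

lemma lintegral_exp_centered_le {P : Measure V} [IsProbabilityMeasure P] {a : V}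
    {S B : ℝ} (hS : 0 < S) (hB1 : 1 ≤ B)
    (hB : ∫⁻ y, ENNReal.ofReal (Real.exp (‖y - a‖ ^ 2 / S ^ 2)) ∂P ≤ ENNReal.ofReal B)
    {g : V → ℝ} {l : ℝ} (hg : ∀ y y', |g y - g y'| ≤ l * ‖y - y'‖)
    (hgm : Measurable g) (hgi : Integrable g P) (s : ℝ) :
    ∫⁻ y, ENNReal.ofReal (Real.exp (s * (g y - ∫ y', g y' ∂P))) ∂P ≤
      ENNReal.ofReal (Real.exp (B ^ 2 * (2 * s ^ 2 * l ^ 2 * S ^ 2))) := by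
  set w : ℝ := 2 * s ^ 2 * l ^ 2 * S ^ 2 with hw
  have hw0 : 0 ≤ w := by positivity
  have hew : 0 ≤ Real.exp w - 1 := by linarith [Real.one_le_exp hw0]
  calc ∫⁻ y, ENNReal.ofReal (Real.exp (s * (g y - ∫ y', g y' ∂P))) ∂P
      ≤ ∫⁻ y, ∫⁻ y', ENNReal.ofReal (Real.exp (s * g y - s * g y')) ∂P ∂P := by
        refine lintegral_mono fun y => ?_
        refine le_trans (le_of_eq ?_) (ofReal_exp_integral_le
          ((integrable_const (s * g y)).sub (hgi.const_mul s)))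
        congr 2
        rw [integral_sub (integrable_const _) (hgi.const_mul s), integral_const_mul]
        simp [mul_sub, integral_const_mul]
    _ = ∫⁻ y, ∫⁻ y', ENNReal.ofReal (Real.cosh (s * g y - s * g y')) ∂P ∂P :=
        lintegral_exp_sub_eq_lintegral_cosh_sub (hgm.const_mul s)
    _ ≤ ∫⁻ y, ∫⁻ y', (1 + ENNReal.ofReal (Real.exp w - 1) *
          (ENNReal.ofReal (Real.exp (‖y - a‖ ^ 2 / S ^ 2)) *
            ENNReal.ofReal (Real.exp (‖y' - a‖ ^ 2 / S ^ 2)))) ∂P ∂P := by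
        refine lintegral_mono fun y => lintegral_mono fun y' => ?_
        rw [← ENNReal.ofReal_mul (Real.exp_pos _).le, ← ENNReal.ofReal_mul hew,
          ← ENNReal.ofReal_one, ← ENNReal.ofReal_add zero_le_one (by positivity),
          ← Real.exp_add]
        refine ENNReal.ofReal_le_ofReal ?_
        have h1 : Real.cosh (s * g y - s * g y') ≤
            Real.cosh ((√2 * s * l * S) * (‖y - y'‖ / (√2 * S))) := by
          rw [Real.cosh_le_cosh, ← mul_sub, abs_mul]
          have : (√2 * s * l * S) * (‖y - y'‖ / (√2 * S)) = s * (l * ‖y - y'‖) := by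
            field_simp
          rw [this, abs_mul]
          exact mul_le_mul_of_nonneg_left ((hg y y').trans (le_abs_self _)) (abs_nonneg _)
        refine h1.trans ((cosh_mul_le _ _).trans ?_)
        have h2 : (√2 * s * l * S) ^ 2 = w := by
          rw [hw]; simp only [mul_pow]; rw [Real.sq_sqrt zero_le_two]
        have h3 : (‖y - y'‖ / (√2 * S)) ^ 2 ≤ ‖y - a‖ ^ 2 / S ^ 2 + ‖y' - a‖ ^ 2 / S ^ 2 := by
          rw [div_pow, mul_pow, Real.sq_sqrt zero_le_two, ← add_div,
            div_le_div_iff₀ (by positivity) (by positivity)]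
          have h4 : ‖y - y'‖ ≤ ‖y - a‖ + ‖y' - a‖ := by
            simpa [norm_sub_rev y' a] using norm_sub_le_norm_sub_add_norm_sub y a y'
          have h5 : ‖y - y'‖ ^ 2 ≤ 2 * (‖y - a‖ ^ 2 + ‖y' - a‖ ^ 2) := by
            nlinarith [norm_nonneg (y - y'), sq_nonneg (‖y - a‖ - ‖y' - a‖)]
          nlinarith [sq_nonneg S]
        rw [h2]
        gcongr
    _ = 1 + ENNReal.ofReal (Real.exp w - 1) *
          ((∫⁻ y, ENNReal.ofReal (Real.exp (‖y - a‖ ^ 2 / S ^ 2)) ∂P) *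
            (∫⁻ y, ENNReal.ofReal (Real.exp (‖y - a‖ ^ 2 / S ^ 2)) ∂P)) := by
        have e : ∀ y, ∫⁻ y', (1 + ENNReal.ofReal (Real.exp w - 1) *
          (ENNReal.ofReal (Real.exp (‖y - a‖ ^ 2 / S ^ 2)) *
            ENNReal.ofReal (Real.exp (‖y' - a‖ ^ 2 / S ^ 2)))) ∂P =
            1 + ENNReal.ofReal (Real.exp w - 1) *
          (ENNReal.ofReal (Real.exp (‖y - a‖ ^ 2 / S ^ 2)) *
            ∫⁻ y', ENNReal.ofReal (Real.exp (‖y' - a‖ ^ 2 / S ^ 2)) ∂P) := by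
          intro y
          rw [lintegral_add_left (by fun_prop), lintegral_const_mul _ (by fun_prop),
            lintegral_const_mul _ (by fun_prop)]
          simp
        simp_rw [e]
        rw [lintegral_add_left (by fun_prop), lintegral_const_mul _ (by fun_prop),
            lintegral_mul_const _ (by fun_prop)]
        simp
    _ ≤ 1 + ENNReal.ofReal (Real.exp w - 1) * (ENNReal.ofReal B * ENNReal.ofReal B) := by
        gcongr
    _ = ENNReal.ofReal (1 + (Real.exp w - 1) * B ^ 2) := by
        rw [← ENNReal.ofReal_mul (by linarith), ← ENNReal.ofReal_mul hew, ← ENNReal.ofReal_one,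
          ← ENNReal.ofReal_add zero_le_one (by positivity), sq]
    _ ≤ _ := ENNReal.ofReal_le_ofReal
        (one_add_exp_sub_one_mul_le (by nlinarith))

lemma continuous_of_abs_sub_le_sum {V : Type*} [NormedAddCommGroup V] {n : ℕ}
    {F : (Fin n → V) → ℝ} {l : ℝ} (hF : ∀ y y', |F y - F y'| ≤ l * ∑ i, ‖y i - y' i‖) :
    Continuous F := by
  refine continuous_iff_continuousAt.2 fun y => tendsto_iff_dist_tendsto_zero.2 ?_
  refine squeeze_zero (fun _ => dist_nonneg) (fun z => hF z y) ?_
  have : Continuous fun z : Fin n → V => l * ∑ i, ‖z i - y i‖ := by fun_prop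
  simpa using this.tendsto y

lemma integrable_pi_of_abs_sub_le_sum {P : Measure V} [IsProbabilityMeasure P] {n : ℕ}
    (hP : Integrable (fun y => ‖y‖) P) {F : (Fin n → V) → ℝ} {l : ℝ}
    (hF : ∀ y y', |F y - F y'| ≤ l * ∑ i, ‖y i - y' i‖) :
    Integrable F (Measure.pi fun _ : Fin n => P) := by
  have hi : ∀ i : Fin n, Integrable (fun y : Fin n → V => ‖y i‖) (Measure.pi fun _ => P) :=
    fun i => (measurePreserving_eval (fun _ : Fin n => P) i).integrable_comp_of_integrable hP
  refine ((integrable_const |F 0|).add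
    ((integrable_finsetSum Finset.univ fun i _ => hi i).const_mul l)).mono'
    (continuous_of_abs_sub_le_sum hF).measurable.aestronglyMeasurable
    (Eventually.of_forall fun y => ?_)
  have h1 := hF y 0
  have h2 : |F y| ≤ |F 0| + |F y - F 0| := by
    simpa using abs_add_le (F 0) (F y - F 0)
  simp only [Pi.zero_apply, sub_zero] at h1
  simp only [Real.norm_eq_abs, Pi.add_apply]
  linarith

lemma lintegral_exp_pi_centered_le {P : Measure V} [IsProbabilityMeasure P] {a : V}
    {S B : ℝ} (hS : 0 < S) (hB1 : 1 ≤ B)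
    (hB : ∫⁻ y, ENNReal.ofReal (Real.exp (‖y - a‖ ^ 2 / S ^ 2)) ∂P ≤ ENNReal.ofReal B)
    {l : ℝ} (s : ℝ) (n : ℕ) (F : (Fin n → V) → ℝ)
    (hF : ∀ y y', |F y - F y'| ≤ l * ∑ i, ‖y i - y' i‖) :
    ∫⁻ y, ENNReal.ofReal (Real.exp (s * (F y - ∫ y', F y' ∂(Measure.pi fun _ => P))))
        ∂(Measure.pi fun _ => P) ≤
      ENNReal.ofReal (Real.exp (n * (B ^ 2 * (2 * s ^ 2 * l ^ 2 * S ^ 2)))) := by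
  have hP := integrable_norm_of_lintegral_exp_sq hS hB
  induction n with
  | zero =>
    obtain ⟨c, rfl⟩ : ∃ c, F = fun _ => c :=
      ⟨F default, funext fun y => congrArg F (Subsingleton.elim _ _)⟩
    simp
  | succ n ih =>
    set K := B ^ 2 * (2 * s ^ 2 * l ^ 2 * S ^ 2)
    set Q : Measure (Fin n → V) := Measure.pi fun _ => P
    have mp := (measurePreserving_piFinSuccAbove (fun _ : Fin (n + 1) => P) 0).symm
    have hFi := integrable_pi_of_abs_sub_le_sum hP hF
    have hFc := (continuous_of_abs_sub_le_sum hF)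
    have hcons : ∀ p : V × (Fin n → V),
        (MeasurableEquiv.piFinSuccAbove (fun _ : Fin (n + 1) => V) 0).symm p
          = Fin.cons p.1 p.2 := by
      intro p
      simp [MeasurableEquiv.piFinSuccAbove_symm_apply, Fin.insertNthEquiv]
    have hFi' : Integrable (fun p : V × (Fin n → V) => F (Fin.cons p.1 p.2)) (P.prod Q) := by
      have := (mp.integrable_comp_emb (MeasurableEquiv.measurableEmbedding _)).2 hFi
      refine this.congr (Eventually.of_forall fun p => ?_)
      simp only [Function.comp_apply, hcons]
    have hcm : Continuous fun p : V × (Fin n → V) =>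
        (Fin.cons p.1 p.2 : Fin (n + 1) → V) := by
      fun_prop
    set g : V → ℝ := fun x => ∫ z, F (Fin.cons x z) ∂Q with hgdef
    have hslice : ∀ x z z', |F (Fin.cons x z) - F (Fin.cons x z')| ≤ l * ∑ i, ‖z i - z' i‖ := by
      intro x z z'
      simpa [Fin.sum_univ_succ] using hF (Fin.cons x z) (Fin.cons x z')
    have hg : ∀ x x', |g x - g x'| ≤ l * ‖x - x'‖ := by
      intro x x'
      rw [hgdef, ← integral_sub (integrable_pi_of_abs_sub_le_sum hP (hslice x))
        (integrable_pi_of_abs_sub_le_sum hP (hslice x')), ← Real.norm_eq_abs]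
      refine (norm_integral_le_of_norm_le_const (C := l * ‖x - x'‖)
        (Eventually.of_forall fun z => ?_)).trans (by simp)
      simpa [Fin.sum_univ_succ] using hF (Fin.cons x z) (Fin.cons x' z)
    have hgm : Measurable g := by
      have := hFc.comp hcm
      exact (StronglyMeasurable.integral_prod_right (ν := Q)
        (f := fun x z => F (Fin.cons x z)) this.stronglyMeasurable).measurable
    have hgi : Integrable g P := hFi'.integral_prod_left
    have hEF : ∫ y, F y ∂(Measure.pi fun _ => P) = ∫ x, g x ∂P := by
      rw [← mp.integral_comp' F]
      simp_rw [hcons]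
      exact integral_prod _ hFi'
    rw [hEF, ← mp.lintegral_comp_emb (MeasurableEquiv.measurableEmbedding _)]
    simp_rw [hcons]
    rw [lintegral_prod _ (by
      have := (hFc.comp hcm).measurable
      simp only [Function.comp_def] at this
      fun_prop)]
    calc ∫⁻ x, ∫⁻ z, ENNReal.ofReal (Real.exp (s * (F (Fin.cons x z) - ∫ x, g x ∂P))) ∂Q ∂P
        = ∫⁻ x, ENNReal.ofReal (Real.exp (s * (g x - ∫ x, g x ∂P))) *
            ∫⁻ z, ENNReal.ofReal (Real.exp (s * (F (Fin.cons x z) - g x))) ∂Q ∂P := by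
          refine lintegral_congr fun x => ?_
          have hm : Measurable fun z => F (Fin.cons x z) :=
            (continuous_of_abs_sub_le_sum (hslice x)).measurable
          rw [← lintegral_const_mul _ (by fun_prop)]
          refine lintegral_congr fun z => ?_
          rw [← ENNReal.ofReal_mul (Real.exp_pos _).le, ← Real.exp_add]
          congr 2
          ring
      _ ≤ ∫⁻ x, ENNReal.ofReal (Real.exp (s * (g x - ∫ x, g x ∂P))) *
            ENNReal.ofReal (Real.exp (n * K)) ∂P := by
          refine lintegral_mono fun x => ?_
          gcongr
          exact ih _ (hslice x)
      _ = (∫⁻ x, ENNReal.ofReal (Real.exp (s * (g x - ∫ x, g x ∂P))) ∂P) *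
            ENNReal.ofReal (Real.exp (n * K)) := lintegral_mul_const _ (by fun_prop)
      _ ≤ ENNReal.ofReal (Real.exp K) * ENNReal.ofReal (Real.exp (n * K)) := by
          gcongr
          exact lintegral_exp_centered_le hS hB1 hB hg hgm hgi s
      _ = _ := by
          rw [← ENNReal.ofReal_mul (Real.exp_pos _).le, ← Real.exp_add]
          congr 2
          push_cast
          ring

lemma measure_pi_le_sub_integral_le {P : Measure V} [IsProbabilityMeasure P] {a : V}
    {S B : ℝ} (hS : 0 < S) (hB1 : 1 ≤ B)
    (hB : ∫⁻ y, ENNReal.ofReal (Real.exp (‖y - a‖ ^ 2 / S ^ 2)) ∂P ≤ ENNReal.ofReal B)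
    {n : ℕ} (hn : 0 < n) (F : (Fin n → V) → ℝ)
    (hF : ∀ y y', |F y - F y'| ≤ (n : ℝ)⁻¹ * ∑ i, ‖y i - y' i‖) {x : ℝ} (hx : 0 < x) :
    (Measure.pi fun _ => P) {y | x ≤ F y - ∫ y', F y' ∂(Measure.pi fun _ => P)} ≤
      ENNReal.ofReal (Real.exp (-(n * x ^ 2 / (8 * B ^ 2 * S ^ 2)))) := by
  have hB0 : 0 < B := one_pos.trans_le hB1
  have hn' : (0 : ℝ) < n := by exact_mod_cast hn
  set s : ℝ := n * x / (4 * B ^ 2 * S ^ 2) with hs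
  have hs0 : 0 < s := by positivity
  have hFm := (continuous_of_abs_sub_le_sum hF).measurable
  have h1 := lintegral_exp_pi_centered_le hS hB1 hB s n F hF
  set m := ∫ y', F y' ∂(Measure.pi fun _ => P)
  calc (Measure.pi fun _ => P) {y | x ≤ F y - m}
      ≤ (Measure.pi fun _ => P) {y | ENNReal.ofReal (Real.exp (s * x)) ≤
          ENNReal.ofReal (Real.exp (s * (F y - m)))} := by
        refine measure_mono fun y hy => ?_
        simp only [mem_ofPred_eq] at hy ⊢
        gcongr
    _ ≤ (∫⁻ y, ENNReal.ofReal (Real.exp (s * (F y - m))) ∂(Measure.pi fun _ => P)) /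
          ENNReal.ofReal (Real.exp (s * x)) :=
        meas_ge_le_lintegral_div (by fun_prop) (by simp [Real.exp_pos]) ENNReal.ofReal_ne_top
    _ ≤ _ := by
        refine (ENNReal.div_le_div_right h1 _).trans (le_of_eq ?_)
        rw [← ENNReal.ofReal_div_of_pos (Real.exp_pos _), ← Real.exp_sub]
        congr 2
        rw [hs]
        field_simp
        ring

lemma measure_pi_le_abs_sub_integral_le {P : Measure V} [IsProbabilityMeasure P] {a : V}
    {S B : ℝ} (hS : 0 < S) (hB1 : 1 ≤ B)
    (hB : ∫⁻ y, ENNReal.ofReal (Real.exp (‖y - a‖ ^ 2 / S ^ 2)) ∂P ≤ ENNReal.ofReal B)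
    {n : ℕ} (hn : 0 < n) (F : (Fin n → V) → ℝ)
    (hF : ∀ y y', |F y - F y'| ≤ (n : ℝ)⁻¹ * ∑ i, ‖y i - y' i‖) {x : ℝ} (hx : 0 < x) :
    (Measure.pi fun _ => P) {y | x ≤ |F y - ∫ y', F y' ∂(Measure.pi fun _ => P)|} ≤
      ENNReal.ofReal (2 * Real.exp (-(n * x ^ 2 / (8 * B ^ 2 * S ^ 2)))) := by
  have h1 := measure_pi_le_sub_integral_le hS hB1 hB hn F hF hx
  have h2 := measure_pi_le_sub_integral_le hS hB1 hB hn (fun y => -F y)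
    (fun y y' => by simpa [abs_sub_comm, neg_add_eq_sub] using hF y y') hx
  rw [integral_neg] at h2
  rw [two_mul, ENNReal.ofReal_add (Real.exp_pos _).le (Real.exp_pos _).le]
  refine (measure_mono fun y hy => ?_).trans ((measure_union_le _ _).trans (add_le_add h1 h2))
  simp only [mem_ofPred_eq, mem_union] at hy ⊢
  rcases le_abs.1 hy with h | h
  · exact Or.inl h
  · exact Or.inr (by linarith)

end Concentration

lemma W1_le_add_of_mem_Cpl {α : Type*} [MeasurableSpace α] [PseudoEMetricSpace α]
    [OpensMeasurableSpace α] [SecondCountableTopology α] [StandardBorelSpace α] [Nonempty α]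
    {μ ν ρ : Measure α} [IsProbabilityMeasure ν] {θ : Measure (α × α)} (hθ : θ ∈ Cpl ν ρ) :
    W1 μ ρ ≤ W1 μ ν + ∫⁻ p, edist p.1 p.2 ∂θ := by
  obtain ⟨hθ1, hθ2⟩ := hθ
  have hfinθ : IsFiniteMeasure θ := by
    refine ⟨?_⟩
    have := congrArg (fun m : Measure α => m univ) hθ1
    simp only [Measure.map_apply measurable_fst MeasurableSet.univ, preimage_univ] at this
    rw [this]
    exact measure_lt_top _ _
  rw [W1, W1, ENNReal.iInf_add]
  refine le_iInf fun π => ?_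
  rw [ENNReal.iInf_add]
  refine le_iInf fun hπ => ?_
  obtain ⟨hπ1, hπ2⟩ := hπ
  have hfinπ : IsFiniteMeasure π := by
    refine ⟨?_⟩
    have := congrArg (fun m : Measure α => m univ) hπ2
    simp only [Measure.map_apply measurable_snd MeasurableSet.univ, preimage_univ] at this
    rw [this]
    exact measure_lt_top _ _
  set η : Measure ((α × α) × α) := π ⊗ₘ (θ.condKernel.comap Prod.snd measurable_snd) with hη
  have hη1 : η.map Prod.fst = π := by
    change η.fst = π
    rw [hη, Measure.fst_compProd]
  have hη2 : η.map (fun q => (q.1.2, q.2)) = θ := by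
    have h : ν ⊗ₘ θ.condKernel = θ := by
      have := θ.disintegrate θ.condKernel
      rwa [Measure.fst, hθ1] at this
    rw [← h]
    ext s hs
    rw [Measure.map_apply (by fun_prop) hs, hη, Measure.compProd_apply
      ((by fun_prop : Measurable fun q : (α × α) × α => (q.1.2, q.2)) hs),
      Measure.compProd_apply hs, ← hπ2,
      lintegral_map (Kernel.measurable_kernel_prodMk_left hs) measurable_snd]
    rfl
  have hmem : η.map (fun q => (q.1.1, q.2)) ∈ Cpl μ ρ := by
    refine ⟨?_, ?_⟩
    · rw [Measure.map_map measurable_fst (by fun_prop), ← hπ1, ← hη1,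
        Measure.map_map measurable_fst measurable_fst]
      rfl
    · rw [Measure.map_map measurable_snd (by fun_prop), ← hθ2, ← hη2,
        Measure.map_map measurable_snd (by fun_prop)]
      rfl
  refine (iInf₂_le _ hmem).trans ?_
  rw [lintegral_map (by fun_prop) (by fun_prop)]
  calc ∫⁻ q, edist q.1.1 q.2 ∂η ≤ ∫⁻ q, edist q.1.1 q.1.2 + edist q.1.2 q.2 ∂η :=
        lintegral_mono fun q => edist_triangle _ _ _
    _ = ∫⁻ q, edist q.1.1 q.1.2 ∂η + ∫⁻ q, edist q.1.2 q.2 ∂η :=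
        lintegral_add_left (by fun_prop) _
    _ = _ := by
        conv_rhs => rw [← hη1, ← hη2]
        rw [lintegral_map (by fun_prop) (by fun_prop), lintegral_map (by fun_prop) (by fun_prop)]

lemma isProbabilityMeasure_empFin {α : Type*} [MeasurableSpace α] {n : ℕ} (hn : 0 < n)
    (y : Fin n → α) : IsProbabilityMeasure (empFin y) := by
  refine ⟨?_⟩
  simp [empFin, ENNReal.inv_mul_cancel, hn.ne']

lemma exists_Cpl_empFin {V : Type*} [NormedAddCommGroup V] [MeasurableSpace V] [BorelSpace V]
    [SecondCountableTopology V] {n : ℕ} (y z : Fin n → V) :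
    ∃ θ ∈ Cpl (empFin y) (empFin z), ∫⁻ p, edist p.1 p.2 ∂θ =
      ENNReal.ofReal ((n : ℝ)⁻¹ * ∑ i, ‖y i - z i‖) := by
  refine ⟨empFin fun i => (y i, z i), ⟨?_, ?_⟩, ?_⟩
  · rw [empFin, Measure.map_smul, Measure.map_finset_sum' measurable_fst.aemeasurable]
    simp [empFin]
  · rw [empFin, Measure.map_smul, Measure.map_finset_sum' measurable_snd.aemeasurable]
    simp [empFin]
  · rcases Nat.eq_zero_or_pos n with rfl | hn
    · simp [empFin]
    rw [empFin, lintegral_smul_measure, lintegral_finsetSum_measure,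
      ENNReal.ofReal_mul (by positivity), ENNReal.ofReal_inv_of_pos (by positivity),
      ENNReal.ofReal_natCast, ENNReal.ofReal_sum_of_nonneg fun i _ => norm_nonneg _]
    simp_rw [lintegral_dirac' _ (by fun_prop : Measurable fun p : V × V => edist p.1 p.2),
      edist_eq_enorm_sub, ofReal_norm]
    rfl

lemma W1_lt_top {V : Type*} [NormedAddCommGroup V] [MeasurableSpace V] [BorelSpace V]
    [SecondCountableTopology V] {P Q : Measure V} [IsProbabilityMeasure P]
    [IsProbabilityMeasure Q] (hP : Integrable (fun y => ‖y‖) P)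
    (hQ : Integrable (fun y => ‖y‖) Q) : W1 P Q < ⊤ := by
  refine (iInf₂_le (P.prod Q) ⟨Measure.fst_prod, Measure.snd_prod⟩).trans_lt ?_
  have h : Integrable (fun p : V × V => ‖p.1‖ + ‖p.2‖) (P.prod Q) :=
    (hP.comp_fst Q).add (hQ.comp_snd P)
  refine lt_of_le_of_lt (lintegral_mono fun p => ?_) h.2
  rw [edist_eq_enorm_sub, ← ofReal_norm, ← ofReal_norm]
  refine ENNReal.ofReal_le_ofReal ((norm_sub_le _ _).trans (le_abs_self _))

lemma integrable_norm_empFin {V : Type*} [NormedAddCommGroup V] [MeasurableSpace V]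
    [BorelSpace V] [SecondCountableTopology V] {n : ℕ} (hn : 0 < n) (y : Fin n → V) :
    Integrable (fun y => ‖y‖) (empFin y) := by
  rw [empFin]
  refine Integrable.smul_measure ?_ (by simp [hn.ne'])
  rw [integrable_finsetSum_measure]
  exact fun i _ => integrable_dirac (by simp)

lemma abs_W1_empFin_sub_le {V : Type*} [NormedAddCommGroup V] [MeasurableSpace V]
    [BorelSpace V] [SecondCountableTopology V] [StandardBorelSpace V] {P : Measure V}
    [IsProbabilityMeasure P] (hP : Integrable (fun y => ‖y‖) P) {n : ℕ} (hn : 0 < n)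
    (y z : Fin n → V) :
    |(W1 P (empFin y)).toReal - (W1 P (empFin z)).toReal| ≤ (n : ℝ)⁻¹ * ∑ i, ‖y i - z i‖ := by
  have key : ∀ y z : Fin n → V, (W1 P (empFin z)).toReal ≤
      (W1 P (empFin y)).toReal + (n : ℝ)⁻¹ * ∑ i, ‖y i - z i‖ := by
    intro y z
    have := isProbabilityMeasure_empFin hn y
    have hfin := W1_lt_top hP (integrable_norm_empFin hn y)
    obtain ⟨θ, hθ, hc⟩ := exists_Cpl_empFin y z
    have h := W1_le_add_of_mem_Cpl (μ := P) hθ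
    rw [hc] at h
    have := ENNReal.toReal_mono (ENNReal.add_ne_top.2 ⟨hfin.ne, ENNReal.ofReal_ne_top⟩) h
    rwa [ENNReal.toReal_add hfin.ne ENNReal.ofReal_ne_top,
      ENNReal.toReal_ofReal (by positivity)] at this
  have h1 := key y z
  have h2 := key z y
  simp_rw [norm_sub_rev (z _)] at h2
  rw [abs_le]
  constructor <;> linarith

lemma exists_forall_nnnorm_le_of_forall_abs_le {d t : ℕ} {G : Set (PathT d t)} {R : ℝ}
    (hR : ∀ a ∈ G, ∀ s i, |a s i| ≤ R) : ∃ C : ℝ≥0, ∀ a ∈ G, ∀ s, ‖a s‖₊ ≤ C := by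
  refine ⟨Real.toNNReal √(∑ _ : Fin d, R ^ 2), fun a ha s => ?_⟩
  rw [← NNReal.coe_le_coe, coe_nnnorm, Real.coe_toNNReal _ (Real.sqrt_nonneg _),
    EuclideanSpace.norm_eq]
  refine Real.sqrt_le_sqrt (Finset.sum_le_sum fun i _ => ?_)
  rw [Real.norm_eq_abs]
  exact pow_le_pow_left₀ (abs_nonneg _) (hR a ha s i) 2

lemma cellNorm_ne_top {d t : ℕ} {G : Set (PathT d t)} {C : ℝ≥0}
    (hC : ∀ a ∈ G, ∀ s, ‖a s‖₊ ≤ C) : cellNorm G ≠ ⊤ := by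
  refine ne_top_of_le_ne_top (b := ∑ _ : Fin t, (C : ℝ≥0∞)) (by simp [ENNReal.mul_eq_top])
    (iSup₂_le fun a ha => Finset.sum_le_sum fun s _ => ?_)
  exact_mod_cast hC a ha s

lemma cellDiam_ne_top {d t : ℕ} {G : Set (PathT d t)} {C : ℝ≥0}
    (hC : ∀ a ∈ G, ∀ s, ‖a s‖₊ ≤ C) : cellDiam G ≠ ⊤ := by
  refine ne_top_of_le_ne_top (b := ∑ _ : Fin t, ((C + C : ℝ≥0) : ℝ≥0∞))
    (by simp [ENNReal.mul_eq_top])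
    (iSup₂_le fun a ha => iSup₂_le fun b hb => Finset.sum_le_sum fun s _ => ?_)
  rw [edist_nndist, ENNReal.coe_le_coe, nndist_eq_nnnorm]
  exact (nnnorm_sub_le _ _).trans (add_le_add (hC a ha s) (hC b hb s))

lemma sumNorm_le_cellNorm {d t : ℕ} {G : Set (PathT d t)} (hG : cellNorm G ≠ ⊤)
    {a : PathT d t} (ha : a ∈ G) : sumNorm a ≤ (cellNorm G).toReal := by
  have h := ENNReal.toReal_mono hG (le_iSup₂ (f := fun (a : PathT d t) (_ : a ∈ G) =>
    ∑ s, (‖a s‖₊ : ℝ≥0∞)) a ha)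
  rw [ENNReal.toReal_sum (by simp)] at h
  simpa [sumNorm] using h

lemma sumDist_le_cellDiam {d t : ℕ} {G : Set (PathT d t)} (hG : cellDiam G ≠ ⊤)
    {a b : PathT d t} (ha : a ∈ G) (hb : b ∈ G) : sumDist a b ≤ (cellDiam G).toReal := by
  have h := ENNReal.toReal_mono hG ((le_iSup₂ (f := fun (b : PathT d t) (_ : b ∈ G) =>
    ∑ s, edist (a s) (b s)) b hb).trans (le_iSup₂ (f := fun (a : PathT d t) (_ : a ∈ G) =>
      ⨆ b ∈ G, ∑ s, edist (a s) (b s)) a ha))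
  rw [ENNReal.toReal_sum (fun s _ => edist_ne_top _ _)] at h
  simpa [sumDist, edist_dist, dist_eq_norm] using h

lemma continuous_coord {d t : ℕ} (s : Fin t) (i : Fin d) :
    Continuous fun a : PathT d t => a s i := by
  fun_prop

lemma measurable_ringIdx {d t : ℕ} : Measurable (ringIdx (d := d) (t := t)) := by
  refine measurable_find _ fun k => IsClosed.measurableSet ?_
  simp only [supA, Finset.sup_le_iff, ofPred_forall]
  refine isClosed_iInter fun p => isClosed_iInter fun _ => ?_
  exact isClosed_le (continuous_coord p.1 p.2).nnnorm continuous_const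

lemma measurableSet_setOf_floor_eq {d t : ℕ} {f : ℝ → ℝ} (hf : Measurable f) (z : Idx d t) :
    MeasurableSet {a : PathT d t | ∀ s i, ⌊f (a s i)⌋ = z s i} := by
  simp only [ofPred_forall]
  refine MeasurableSet.iInter fun s => MeasurableSet.iInter fun i => ?_
  exact (Int.measurable_floor.comp (hf.comp (continuous_coord s i).measurable))
    (measurableSet_singleton (z s i))

lemma measurableSet_of_mem_cells {d t m : ℕ} {G : Set (PathT d t)}
    (hG : G ∈ unifCells d t m ∪ nonUnifCells d t m) : MeasurableSet G := by
  rcases hG with ⟨z, rfl⟩ | ⟨⟨j, z⟩, rfl⟩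
  · exact measurableSet_setOf_floor_eq (f := fun u => u * m) (by fun_prop) z
  · exact (measurable_ringIdx (measurableSet_singleton j)).inter
      (measurableSet_setOf_floor_eq (f := fun u => u / sideLen m j) (by fun_prop) z)

lemma exists_forall_nnnorm_le_of_mem_cells {d t m : ℕ} (hm : 1 ≤ m) {G : Set (PathT d t)}
    (hG : G ∈ unifCells d t m ∪ nonUnifCells d t m) :
    ∃ C : ℝ≥0, ∀ a ∈ G, ∀ s, ‖a s‖₊ ≤ C := by
  rcases hG with ⟨z, rfl⟩ | ⟨⟨j, z⟩, rfl⟩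
  · refine exists_forall_nnnorm_le_of_forall_abs_le (R := ∑ s, ∑ i, (|(z s i : ℝ)| + 1))
      fun a ha s i => ?_
    have hm' : (1 : ℝ) ≤ m := by exact_mod_cast hm
    have h1 : |a s i| ≤ |a s i * m| := by
      rw [abs_mul, abs_of_nonneg (by linarith : (0 : ℝ) ≤ m)]
      exact le_mul_of_one_le_right (abs_nonneg _) hm'
    have h2 : |a s i * m| ≤ |(z s i : ℝ)| + 1 := by
      have h3 := Int.floor_le (a s i * m)
      have h4 := Int.lt_floor_add_one (a s i * m)
      rw [ha s i] at h3 h4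
      rw [abs_le]
      constructor
      · linarith [neg_abs_le (z s i : ℝ)]
      · linarith [le_abs_self (z s i : ℝ)]
    refine h1.trans (h2.trans ?_)
    refine (Finset.single_le_sum (f := fun i => |(z s i : ℝ)| + 1) (fun i _ => by positivity)
      (Finset.mem_univ i)).trans ?_
    exact Finset.single_le_sum (f := fun s => ∑ i, (|(z s i : ℝ)| + 1))
      (fun s _ => by positivity) (Finset.mem_univ s)
  · refine exists_forall_nnnorm_le_of_forall_abs_le (R := 2 ^ j) fun a ha s i => ?_
    have h : supA a ≤ 2 ^ j := by
      have hj : ringIdx a = j := ha.1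
      rw [← hj]
      exact Nat.find_spec (ringIdx_ex a)
    have h2 := (Finset.le_sup (f := fun p : Fin t × Fin d => ‖a p.1 p.2‖₊)
      (Finset.mem_univ (s, i))).trans h
    exact_mod_cast h2

lemma one_le_mOf {d T N : ℕ} (hN : 1 ≤ N) : 1 ≤ mOf d T N := by
  rw [mOf, Nat.one_le_ceil_iff, ΔN]
  have : (0 : ℝ) < N := by exact_mod_cast hN
  positivity

lemma measurable_restr {d T t : ℕ} (h : t ≤ T) : Measurable (restr d T h) :=
  measurable_pi_lambda _ fun _ => measurable_pi_apply _

lemma isProbabilityMeasure_avgKer {d T : ℕ} (μ : Measure (PathT d T)) [IsProbabilityMeasure μ]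
    {t : ℕ} (ht : t < T) (G : Set (PathT d t)) : IsProbabilityMeasure (avgKer μ ht G) := by
  unfold avgKer
  split_ifs with h
  · infer_instance
  · refine ⟨?_⟩
    rw [Measure.smul_apply, Measure.map_apply (measurable_pi_apply _) MeasurableSet.univ]
    simp [ENNReal.inv_mul_cancel h (measure_ne_top _ _)]

lemma IsDisint.map_restrict_eq_bind {d T : ℕ} {μ : Measure (PathT d T)} {t : ℕ} {ht : t < T}
    {K : PathT d t → Measure (E d)} (hK : IsDisint μ ht K) {G : Set (PathT d t)}
    (hG : MeasurableSet G) :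
    (μ.restrict (restr d T ht.le ⁻¹' G)).map (fun x => x ⟨t, ht⟩) =
      ((μ.map (restr d T ht.le)).restrict G).bind K := by
  ext B hB
  have hcoord : Measurable fun x : PathT d T => x ⟨t, ht⟩ := measurable_pi_apply _
  rw [Measure.bind_apply hB (Measure.measurable_of_measurable_coe _ hK.2.1).aemeasurable,
    Measure.map_apply hcoord hB, Measure.restrict_apply (hcoord hB), inter_comm]
  exact hK.2.2 G B hG hB

lemma IsDisint.lintegral_avgKer_le {d T : ℕ} {μ : Measure (PathT d T)} [IsProbabilityMeasure μ]
    {t : ℕ} {ht : t < T} {K : PathT d t → Measure (E d)} (hK : IsDisint μ ht K)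
    {G : Set (PathT d t)} (hG : MeasurableSet G) (h0 : μ (restr d T ht.le ⁻¹' G) ≠ 0)
    {φ : E d → ℝ≥0∞} (hφ : Measurable φ) {B : ℝ≥0∞} (hB : ∀ a ∈ G, ∫⁻ y, φ y ∂(K a) ≤ B) :
    ∫⁻ y, φ y ∂(avgKer μ ht G) ≤ B := by
  rw [avgKer, if_neg h0, lintegral_smul_measure, hK.map_restrict_eq_bind hG,
    Measure.lintegral_bind (Measure.measurable_of_measurable_coe _ hK.2.1).aemeasurable
      hφ.aemeasurable]
  calc _ ≤ (μ (restr d T ht.le ⁻¹' G))⁻¹ * ∫⁻ _ in G, B ∂(μ.map (restr d T ht.le)) := by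
        rw [smul_eq_mul]
        gcongr 1
        exact setLIntegral_mono' hG hB
    _ = B := by
        rw [setLIntegral_const, Measure.map_apply (measurable_restr _) hG, mul_comm B,
          ← mul_assoc, ENNReal.inv_mul_cancel h0 (measure_ne_top _ _), one_mul]

lemma Setting3.exists_lintegral_avgKer_le {d T : ℕ} {r α γ L Lf : ℝ} {μ : Measure (PathT d T)}
    {κ : KernelData d T μ} (hS : Setting3 d T r α γ L Lf μ κ) :
    ∃ S B : ℝ, 0 < S ∧ 1 ≤ B ∧ ∀ (t : ℕ) (ht : t < T), 1 ≤ t → ∀ G : Set (PathT d t),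
      MeasurableSet G → cellNorm G ≠ ⊤ → cellDiam G ≠ ⊤ → ∃ a : E d,
        ∫⁻ y, ENNReal.ofReal (Real.exp (‖y - a‖ ^ 2 /
          (S * ((1 + (cellDiam G).toReal) * (1 + (cellNorm G).toReal ^ r))) ^ 2))
          ∂(avgKer μ ht G) ≤ ENNReal.ofReal B := by
  have := hS.hprob
  obtain ⟨c, hc, hgrow⟩ := hS.hgrow
  obtain ⟨M, hM, hlam⟩ := hS.hulam
  have hγ := hS.hγ
  have hLf := hS.hLf
  set C := Lf + c with hC
  have hC0 : 0 < C := by positivity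
  set S := √(2 * C ^ 2 / γ) with hSdef
  have hS0 : 0 < S := by positivity
  have hS2 : S ^ 2 = 2 * C ^ 2 / γ := Real.sq_sqrt (by positivity)
  set B := 1 + Real.exp (2 * γ) * M.toReal with hBdef
  refine ⟨S, B, hS0, by rw [hBdef]; linarith [show 0 ≤ Real.exp (2 * γ) * M.toReal by positivity],
    fun t ht h1t G hG hn hd => ?_⟩
  set D := (cellDiam G).toReal
  set R := (cellNorm G).toReal ^ r
  have hD : 0 ≤ D := ENNReal.toReal_nonneg
  have hR : 0 ≤ R := Real.rpow_nonneg ENNReal.toReal_nonneg _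
  by_cases h0 : μ (restr d T ht.le ⁻¹' G) = 0
  · refine ⟨0, ?_⟩
    rw [avgKer, if_pos h0, lintegral_dirac' _ (by fun_prop)]
    refine ENNReal.ofReal_le_ofReal ?_
    simp only [sub_zero, norm_zero, ne_eq, OfNat.ofNat_ne_zero, not_false_eq_true, zero_pow,
      zero_div, Real.exp_zero, hBdef]
    linarith [show 0 ≤ Real.exp (2 * γ) * M.toReal by positivity]
  obtain ⟨x₀, ha₀⟩ := nonempty_of_measure_ne_zero h0
  set a₀ := restr d T ht.le x₀
  refine ⟨κ.f t ht a₀, (κ.disint t ht h1t).lintegral_avgKer_le hG h0 (by fun_prop) fun b hb => ?_⟩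
  rw [κ.decomp t ht b h1t, lintegral_map (by fun_prop) (by fun_prop)]
  have key : ∀ e : E d, ‖κ.f t ht b + κ.sig t ht b • e - κ.f t ht a₀‖ ^ 2 /
      (S * ((1 + D) * (1 + R))) ^ 2 ≤ 2 * γ + γ * ‖e‖ ^ α := by
    intro e
    have hf : ‖κ.f t ht b - κ.f t ht a₀‖ ≤ Lf * D :=
      (hS.hfLip t ht h1t b a₀).trans (by gcongr; exact sumDist_le_cellDiam hd hb ha₀)
    have hs : κ.sig t ht b ≤ c * R :=
      (hgrow t ht b h1t).trans (mul_le_mul_of_nonneg_left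
        (Real.rpow_le_rpow (Finset.sum_nonneg fun s _ => norm_nonneg (b s))
          (sumNorm_le_cellNorm hn hb) hS.hr) hc.le)
    have h1 : ‖κ.f t ht b + κ.sig t ht b • e - κ.f t ht a₀‖ ≤
        C * ((1 + D) * (1 + R)) * (1 + ‖e‖) := by
      calc _ = ‖(κ.f t ht b - κ.f t ht a₀) + κ.sig t ht b • e‖ := by congr 1; abel
        _ ≤ ‖κ.f t ht b - κ.f t ht a₀‖ + κ.sig t ht b * ‖e‖ := by
            refine (norm_add_le _ _).trans ?_
            rw [norm_smul, Real.norm_of_nonneg (κ.sigNonneg t ht b)]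
        _ ≤ Lf * D + c * R * ‖e‖ := by gcongr
        _ ≤ Lf * ((1 + D) * (1 + R) * (1 + ‖e‖)) + c * ((1 + D) * (1 + R) * (1 + ‖e‖)) := by
            have he := norm_nonneg e
            gcongr ?_ + ?_
            · refine mul_le_mul_of_nonneg_left ?_ hLf.le
              nlinarith [mul_nonneg hD hR, mul_nonneg (mul_nonneg (add_nonneg zero_le_one hD)
                (add_nonneg zero_le_one hR)) he]
            · rw [mul_assoc]
              refine mul_le_mul_of_nonneg_left ?_ hc.le
              nlinarith [mul_nonneg hD hR, mul_nonneg hR he, mul_nonneg hD he,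
                mul_nonneg (mul_nonneg hD hR) he]
        _ = _ := by rw [hC]; ring
    have h2 : ‖e‖ ^ 2 ≤ 1 + ‖e‖ ^ α := by
      rcases le_total ‖e‖ 1 with h | h
      · have := Real.rpow_nonneg (norm_nonneg e) α
        nlinarith [norm_nonneg e]
      · have := Real.rpow_le_rpow_of_exponent_le h hS.hα
        rw [Real.rpow_two] at this
        linarith
    rw [div_le_iff₀ (by positivity)]
    calc _ ≤ (C * ((1 + D) * (1 + R)) * (1 + ‖e‖)) ^ 2 := by gcongr
      _ = C ^ 2 * ((1 + D) * (1 + R)) ^ 2 * (1 + ‖e‖) ^ 2 := by ring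
      _ ≤ C ^ 2 * ((1 + D) * (1 + R)) ^ 2 * (2 * (2 + ‖e‖ ^ α)) := by
          gcongr
          nlinarith [sq_nonneg (1 - ‖e‖)]
      _ = _ := by
          rw [mul_pow S, hS2]
          field_simp
  calc _ ≤ ∫⁻ e, ENNReal.ofReal (Real.exp (2 * γ)) *
        ENNReal.ofReal (Real.exp (γ * ‖e‖ ^ α)) ∂(κ.lam t ht b) := by
        refine lintegral_mono fun e => ?_
        rw [← ENNReal.ofReal_mul (Real.exp_pos _).le, ← Real.exp_add]
        exact ENNReal.ofReal_le_ofReal (Real.exp_le_exp.2 (key e))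
    _ = ENNReal.ofReal (Real.exp (2 * γ)) * ExpM α γ (κ.lam t ht b) := by
        rw [lintegral_const_mul _ (by fun_prop), ExpM]
    _ ≤ ENNReal.ofReal (Real.exp (2 * γ)) * M := by
        gcongr
        exact hlam t ht h1t b
    _ ≤ ENNReal.ofReal B := by
        rw [← ENNReal.ofReal_toReal hM, ← ENNReal.ofReal_mul (Real.exp_pos _).le]
        refine ENNReal.ofReal_le_ofReal ?_
        rw [hBdef]
        linarith

end AWPaper

open AWPaper in
/-- Lemma 6.3: under Setting 3 there exists `c > 0` such that for every
cube `G` of either grid, all `x > 0` and all sample sizes `N_G`,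
`P[|W(μ_G,(μ_G)^{N_G}) - E[W(μ_G,(μ_G)^{N_G})]| ≥ x]
  ≤ 2 exp(-c N_G x² / ((1+diam G)²(1+‖G‖^r)²))`. -/
theorem exp_deviation_shift_amp
    {d T : ℕ} {r α γ L Lf : ℝ} {μ : Measure (PathT d T)}
    (κ : KernelData d T μ) (hS : Setting3 d T r α γ L Lf μ κ) :
    ∃ c : ℝ, 0 < c ∧ ∀ (t : ℕ) (ht : t < T), 1 ≤ t → ∀ N : ℕ, 1 ≤ N →
      ∀ G ∈ unifCells d t (mOf d T N) ∪ nonUnifCells d t (mOf d T N),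
      ∀ x : ℝ, 0 < x → ∀ NG : ℕ, 1 ≤ NG →
      (Measure.pi (fun _ : Fin NG => avgKer μ ht G))
          {y | x ≤ |(W1 (avgKer μ ht G) (empFin y)).toReal
                    - ∫ y', (W1 (avgKer μ ht G) (empFin y')).toReal
                        ∂(Measure.pi (fun _ : Fin NG => avgKer μ ht G))|}
        ≤ ENNReal.ofReal (2 * Real.exp (-(c * NG * x ^ 2 /
            ((1 + (cellDiam G).toReal) ^ 2 * (1 + (cellNorm G).toReal ^ r) ^ 2)))) := by
  obtain ⟨S, B, hS0, hB1, H⟩ := hS.exists_lintegral_avgKer_le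
  have := hS.hprob
  refine ⟨1 / (8 * B ^ 2 * S ^ 2), by positivity, fun t ht h1t N hN G hG x hx n hn => ?_⟩
  obtain ⟨C, hC⟩ := exists_forall_nnnorm_le_of_mem_cells (one_le_mOf hN) hG
  obtain ⟨a, ha⟩ := H t ht h1t G (measurableSet_of_mem_cells hG) (cellNorm_ne_top hC)
    (cellDiam_ne_top hC)
  have := isProbabilityMeasure_avgKer μ ht G
  have hscale : 0 < S * ((1 + (cellDiam G).toReal) * (1 + (cellNorm G).toReal ^ r)) := by
    positivity
  have hintg := integrable_norm_of_lintegral_exp_sq hscale ha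
  refine (measure_pi_le_abs_sub_integral_le hscale hB1 ha hn
    (fun y => (W1 (avgKer μ ht G) (empFin y)).toReal)
    (abs_W1_empFin_sub_le hintg hn) hx).trans (le_of_eq ?_)
  congr 4
  field_simp
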